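/- For real parameters μ, ν > (q−1)/2, the matrix beta integral ∫_{Π_q^I} det(y)^{μ−(q+1)/2} det(I_q − y)^{ν−(q+1)/2} dy = Γ_Ω(μ)Γ_Ω(ν)/Γ_Ω(μ+ν) holds, where Π_q^I = {y real symmetric : 0 ≤ y ≤ I_q} and Γ_Ω(μ) = π^{q(q−1)/4} ∏_{j=1}^{q} Γ(μ − (j−1)/2). -/

import Mathlib

open Matrix MeasureTheory

/-- Index of the upper-triangular coordinates of a symmetric `q×q` matrix. -/
abbrev SymIdx (q : ℕ) := {p : Fin q × Fin q // p.1 ≤ p.2}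

/-- The symmetric matrix with the given upper-triangular coordinates. -/
noncomputable def toSym (q : ℕ) (c : SymIdx q → ℝ) : Matrix (Fin q) (Fin q) ℝ :=
  fun i j => if h : i ≤ j then c ⟨(i, j), h⟩ else c ⟨(j, i), (not_le.mp h).le⟩

noncomputable instance matrixMeasureSpace (q : ℕ) :
    MeasureSpace (Matrix (Fin q) (Fin q) ℝ) :=
  inferInstanceAs (MeasureSpace (Fin q → Fin q → ℝ))

/-- Lebesgue measure on the space of real symmetric `q×q` matrices
(`dy = ∏_{i ≤ j} dy_{ij}`), realized as a measure on the matrix space. -/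
noncomputable def symMeasure (q : ℕ) : Measure (Matrix (Fin q) (Fin q) ℝ) :=
  Measure.map (toSym q) volume

/-- The gamma function of the cone of positive definite real symmetric `q×q` matrices:
`Γ_Ω(μ) = π^{q(q−1)/4} ∏_{j=1}^q Γ(μ − (j−1)/2)`. -/
noncomputable def GammaOmegaR (q : ℕ) (μ : ℝ) : ℝ :=
  Real.pi ^ (((q * (q - 1) : ℕ) : ℝ) / 4) *
    ∏ j ∈ Finset.range q, Real.Gamma (μ - (j : ℝ) / 2)

lemma lintegral_affine_beta {α β s r : ℝ} (hα : -1 < α) (hβ : -1 < β) (hsr : s < r) :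
    ∫⁻ a in Set.Ioo s r, ENNReal.ofReal ((a - s) ^ α * (r - a) ^ β) =
      ENNReal.ofReal ((r - s) ^ (α + β + 1) * ProbabilityTheory.beta (α + 1) (β + 1)) := by
  have hα' : 0 < α + 1 := by linarith
  have hβ' : 0 < β + 1 := by linarith
  have hd : 0 < r - s := sub_pos.2 hsr
  have hB := ProbabilityTheory.beta_pos hα' hβ'
  have himage : Set.Ioo s r = (fun t => (r - s) * t + s) '' Set.Ioo 0 1 := by
    rw [Set.image_affine_Ioo hd]
    congr 1 <;> ring
  have hone := ProbabilityTheory.lintegral_betaPDF_eq_one hα' hβ'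
  rw [ProbabilityTheory.lintegral_betaPDF] at hone
  rw [himage, lintegral_image_eq_lintegral_abs_deriv_mul (f' := fun _ => r - s) measurableSet_Ioo
    (fun x _ => by
      simpa using (((hasDerivAt_id x).const_mul (r - s)).add_const s).hasDerivWithinAt)
    (fun x _ y _ h => by simpa [hd.ne'] using h)]
  calc
    _ = ∫⁻ t in Set.Ioo (0 : ℝ) 1,
          ENNReal.ofReal ((r - s) ^ (α + β + 1) * ProbabilityTheory.beta (α + 1) (β + 1)) *
          ENNReal.ofReal (1 / ProbabilityTheory.beta (α + 1) (β + 1) * t ^ (α + 1 - 1) *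
            (1 - t) ^ (β + 1 - 1)) := by
      refine setLIntegral_congr_fun measurableSet_Ioo fun t ht => ?_
      have h1 : 0 < 1 - t := sub_pos.2 ht.2
      have ht0 := ht.1
      rw [← ENNReal.ofReal_mul (abs_nonneg _), ← ENNReal.ofReal_mul (by positivity)]
      congr 1
      rw [show (r - s) * t + s - s = (r - s) * t by ring,
        show r - ((r - s) * t + s) = (r - s) * (1 - t) by ring, abs_of_pos hd,
        Real.mul_rpow hd.le ht0.le, Real.mul_rpow hd.le h1.le, Real.rpow_add hd, Real.rpow_add hd,
        Real.rpow_one]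
      field_simp
      simp
    _ = _ := by
      rw [lintegral_const_mul' _ _ ENNReal.ofReal_ne_top, hone, mul_one]

lemma lintegral_sub_sq_rpow {p R : ℝ} (hp : -1 < p) (hR : 0 < R) :
    ∫⁻ x in {x : ℝ | 0 < R - x ^ 2}, ENNReal.ofReal ((R - x ^ 2) ^ p) =
      ENNReal.ofReal (R ^ (p + 1 / 2) *
        (√Real.pi * Real.Gamma (p + 1) / Real.Gamma (p + 3 / 2))) := by
  have hr : 0 < √R := Real.sqrt_pos.2 hR
  have hsq : √R ^ 2 = R := Real.sq_sqrt hR.le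
  have hset : {x : ℝ | 0 < R - x ^ 2} = Set.Ioo (-√R) √R := by
    ext x
    simp only [Set.mem_ofPred_eq, Set.mem_Ioo, sub_pos, ← Real.sqrt_lt_sqrt_iff (sq_nonneg x),
      Real.sqrt_sq_eq_abs, abs_lt]
  calc
    _ = ∫⁻ x in Set.Ioo (-√R) √R, ENNReal.ofReal ((x - -√R) ^ p * (√R - x) ^ p) := by
      rw [hset]
      refine setLIntegral_congr_fun measurableSet_Ioo fun x hx => ?_
      rw [← Real.mul_rpow (by linarith [hx.1]) (by linarith [hx.2])]
      congr 2
      linear_combination -hsq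
    _ = _ := by
      rw [lintegral_affine_beta hp hp (by linarith)]
      congr 1
      have hG := Real.Gamma_mul_Gamma_add_half (p + 1)
      have h1 : 0 < Real.Gamma (p + 1) := Real.Gamma_pos_of_pos (by linarith)
      have h2 : 0 < Real.Gamma (p + 3 / 2) := Real.Gamma_pos_of_pos (by linarith)
      have h3 : 0 < Real.Gamma (2 * (p + 1)) := Real.Gamma_pos_of_pos (by linarith)
      have hR' : R ^ (p + 1 / 2) = √R ^ (2 * p + 1) := by
        rw [Real.sqrt_eq_rpow, ← Real.rpow_mul hR.le]
        congr 1
        ring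
      have h2p : (2 : ℝ) ^ (1 - 2 * (p + 1)) * 2 ^ (2 * p + 1) = 1 := by
        rw [← Real.rpow_add two_pos]
        ring_nf
        simp
      rw [ProbabilityTheory.beta, hR', show √R - -√R = 2 * √R by ring,
        Real.mul_rpow two_pos.le hr.le, show p + p + 1 = 2 * p + 1 by ring,
        show p + 1 + (p + 1) = 2 * (p + 1) by ring]
      rw [show p + 1 + 1 / 2 = p + 3 / 2 by ring] at hG
      rw [mul_comm (2 ^ (2 * p + 1) : ℝ), mul_assoc]
      congr 1
      generalize Real.Gamma (p + 3 / 2) = G at *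
      field_simp
      linear_combination (2 : ℝ) ^ (2 * p + 1) * hG +
        Real.Gamma (2 * (p + 1)) * √Real.pi * h2p

lemma lintegral_unitBall_rpow (n : ℕ) {p : ℝ} (hp : -1 < p) :
    ∫⁻ u in {u : Fin n → ℝ | 0 < 1 - u ⬝ᵥ u}, ENNReal.ofReal ((1 - u ⬝ᵥ u) ^ p) =
      ENNReal.ofReal (Real.pi ^ ((n : ℝ) / 2) * Real.Gamma (p + 1) /
        Real.Gamma (p + 1 + n / 2)) := by
  induction n generalizing p with
  | zero =>
    have := (Real.Gamma_pos_of_pos (by linarith : 0 < p + 1)).ne'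
    simp only [dotProduct, Finset.univ_eq_empty, Finset.sum_empty]
    rw [volume_pi, Measure.pi_of_empty]
    simp [div_self this]
  | succ n ih =>
    have hmeas : ∀ k : ℕ, MeasurableSet {u : Fin k → ℝ | 0 < 1 - u ⬝ᵥ u} := fun k =>
      measurableSet_lt measurable_const (by unfold dotProduct; fun_prop)
    rw [← lintegral_indicator (hmeas _),
      ← (volume_preserving_piFinSuccAbove (fun _ : Fin (n + 1) => ℝ) 0).symm.lintegral_comp_emb
        (MeasurableEquiv.measurableEmbedding _), Measure.volume_eq_prod, lintegral_prod_symm]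
    swap
    · refine (Measurable.comp (Measurable.indicator ?_ (hmeas _))
        (MeasurableEquiv.measurable _)).aemeasurable
      unfold dotProduct
      fun_prop
    have hslice : ∀ u : Fin n → ℝ,
        ∫⁻ x : ℝ, {u : Fin (n + 1) → ℝ | 0 < 1 - u ⬝ᵥ u}.indicator
          (fun u => ENNReal.ofReal ((1 - u ⬝ᵥ u) ^ p))
          ((MeasurableEquiv.piFinSuccAbove (fun _ : Fin (n + 1) => ℝ) 0).symm (x, u)) =
        {u : Fin n → ℝ | 0 < 1 - u ⬝ᵥ u}.indicator (fun u =>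
          ENNReal.ofReal ((1 - u ⬝ᵥ u) ^ (p + 1 / 2)) *
          ENNReal.ofReal (√Real.pi * Real.Gamma (p + 1) / Real.Gamma (p + 3 / 2))) u := by
      intro u
      have hdot : ∀ x : ℝ, 1 - (MeasurableEquiv.piFinSuccAbove
          (fun _ : Fin (n + 1) => ℝ) 0).symm (x, u) ⬝ᵥ (MeasurableEquiv.piFinSuccAbove
          (fun _ : Fin (n + 1) => ℝ) 0).symm (x, u) = (1 - u ⬝ᵥ u) - x ^ 2 := by
        intro x
        simp [dotProduct, Fin.sum_univ_succ, MeasurableEquiv.piFinSuccAbove]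
        ring
      simp only [Set.indicator, Set.mem_ofPred_eq, hdot]
      split_ifs with hu
      · have := lintegral_sub_sq_rpow hp hu
        rw [← lintegral_indicator (measurableSet_lt measurable_const (by fun_prop))] at this
        simp only [Set.indicator, Set.mem_ofPred_eq] at this
        rw [this, ENNReal.ofReal_mul (by positivity)]
      · refine (lintegral_congr fun x => if_neg ?_).trans lintegral_zero
        nlinarith [sq_nonneg x]
    simp_rw [hslice]
    rw [lintegral_indicator (hmeas _), lintegral_mul_const' _ _ ENNReal.ofReal_ne_top,
      ih (by linarith), ← ENNReal.ofReal_mul]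
    · congr 1
      have h2 : 0 < Real.Gamma (p + 3 / 2) := Real.Gamma_pos_of_pos (by linarith)
      rw [show p + 1 / 2 + 1 = p + 3 / 2 by ring, show ((n + 1 : ℕ) : ℝ) / 2 = n / 2 + 1 / 2 by
        push_cast; ring, Real.rpow_add Real.pi_pos, Real.sqrt_eq_rpow,
        show p + 1 + ((n : ℝ) / 2 + 1 / 2) = p + 3 / 2 + n / 2 by ring]
      generalize Real.Gamma (p + 3 / 2) = G at *
      field_simp
    · have h1 : 0 < Real.Gamma (p + 1 / 2 + 1) := Real.Gamma_pos_of_pos (by linarith)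
      have h2 : 0 < Real.Gamma (p + 1 / 2 + 1 + n / 2) := Real.Gamma_pos_of_pos (by
        have : (0 : ℝ) ≤ n / 2 := by positivity
        linarith)
      positivity

lemma lintegral_quadForm_rpow {n : ℕ} {p : ℝ} (hp : -1 < p) {M : Matrix (Fin n) (Fin n) ℝ}
    (hM : M.PosDef) :
    ∫⁻ b in {b : Fin n → ℝ | 0 < 1 - b ⬝ᵥ M *ᵥ b}, ENNReal.ofReal ((1 - b ⬝ᵥ M *ᵥ b) ^ p) =
      ENNReal.ofReal (M.det ^ (-(1 / 2) : ℝ)) *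
        ENNReal.ofReal (Real.pi ^ ((n : ℝ) / 2) * Real.Gamma (p + 1) /
          Real.Gamma (p + 1 + n / 2)) := by
  open scoped MatrixOrder in
  obtain ⟨B, rfl⟩ := CStarAlgebra.nonneg_iff_eq_star_mul_self.mp hM.posSemidef.nonneg
  have hdot : ∀ b : Fin n → ℝ, b ⬝ᵥ (star B * B) *ᵥ b = toLin' B b ⬝ᵥ toLin' B b := fun b => by
    rw [← mulVec_mulVec, dotProduct_mulVec, star_eq_conjTranspose, vecMul_conjTranspose]
    simp
  have hdet : (star B * B).det = B.det ^ 2 := by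
    simp [star_eq_conjTranspose, sq]
  have hB : B.det ≠ 0 := fun h => by
    have := hM.det_pos
    simp [hdet, h] at this
  have hmeas : MeasurableSet {u : Fin n → ℝ | 0 < 1 - u ⬝ᵥ u} :=
    measurableSet_lt measurable_const (by unfold dotProduct; fun_prop)
  have hlin : Measurable (toLin' B) := (LinearMap.continuous_of_finiteDimensional _).measurable
  simp_rw [hdot]
  rw [← lintegral_unitBall_rpow n hp]
  refine (setLIntegral_map (μ := volume) (f := fun u => ENNReal.ofReal ((1 - u ⬝ᵥ u) ^ p)) hmeas
    (by unfold dotProduct; fun_prop) hlin).symm.trans ?_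
  rw [Real.map_matrix_volume_pi_eq_smul_volume_pi hB, Measure.restrict_smul, lintegral_smul_measure,
    smul_eq_mul, hdet, Real.rpow_neg (sq_nonneg _), ← Real.sqrt_eq_rpow, Real.sqrt_sq_eq_abs,
    abs_inv]

/-- The matrix obtained from `D` by adding a last column `b`, a last row `bᵀ` and a last diagonal
entry `a`. -/
def bordered {n : Type*} (D : Matrix n n ℝ) (b : n → ℝ) (a : ℝ) :
    Matrix (n ⊕ Fin 1) (n ⊕ Fin 1) ℝ :=
  fromBlocks D (replicateCol (Fin 1) b) (replicateCol (Fin 1) b)ᴴ (of fun _ _ => a)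

lemma one_sub_bordered {n : Type*} [DecidableEq n] {D : Matrix n n ℝ} {b : n → ℝ} {a : ℝ} :
    1 - bordered D b a = bordered (1 - D) (-b) (1 - a) := by
  ext (i | i) (j | j)
  on_goal 4 => obtain rfl := Subsingleton.elim i j
  all_goals simp [bordered, Matrix.one_apply]

lemma posSemidef_of_bordered {n : Type*} {D : Matrix n n ℝ} {b : n → ℝ} {a : ℝ}
    (h : (bordered D b a).PosSemidef) : D.PosSemidef :=
  h.submatrix Sum.inl

section bordered

variable {n : Type*} [Fintype n] [DecidableEq n] {D : Matrix n n ℝ} {b : n → ℝ} {a : ℝ}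

lemma schur_bordered :
    of (fun _ _ => a) - (replicateCol (Fin 1) b)ᴴ * D⁻¹ * replicateCol (Fin 1) b =
      of fun _ _ => a - b ⬝ᵥ D⁻¹ *ᵥ b := by
  ext i j
  rw [Matrix.mul_assoc, ← replicateCol_mulVec]
  simp [Matrix.mul_apply, dotProduct]

lemma det_bordered (hD : D.det ≠ 0) :
    (bordered D b a).det = D.det * (a - b ⬝ᵥ D⁻¹ *ᵥ b) := by
  let := D.invertibleOfIsUnitDet hD.isUnit
  rw [bordered, det_fromBlocks₁₁, invOf_eq_nonsing_inv, schur_bordered]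
  simp

lemma posSemidef_bordered_iff (hD : D.PosDef) :
    (bordered D b a).PosSemidef ↔ b ⬝ᵥ D⁻¹ *ᵥ b ≤ a := by
  let := D.invertibleOfIsUnitDet hD.det_pos.ne'.isUnit
  rw [bordered, Matrix.PosDef.fromBlocks₁₁ _ _ hD, schur_bordered,
    show (of fun _ _ => a - b ⬝ᵥ D⁻¹ *ᵥ b : Matrix (Fin 1) (Fin 1) ℝ) =
      diagonal fun _ => a - b ⬝ᵥ D⁻¹ *ᵥ b by ext i j; simp [Subsingleton.elim i j],
    posSemidef_diagonal_iff]
  simp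

end bordered

/-- The order interval `0 ≤ y ≤ 1` of symmetric matrices. -/
def matrixInterval (n : Type*) [Fintype n] [DecidableEq n] : Set (Matrix n n ℝ) :=
  {y | y.PosSemidef ∧ (1 - y).PosSemidef}

/-- The integrand of the matrix beta integral, extended by zero outside the order interval. -/
noncomputable def matrixBeta {n : Type*} [Fintype n] [DecidableEq n] (α β : ℝ) :
    Matrix n n ℝ → ENNReal :=
  (matrixInterval n).indicator fun y => ENNReal.ofReal (y.det ^ α * (1 - y).det ^ β)

lemma matrixBeta_submatrix {m n : Type*} [Fintype m] [DecidableEq m] [Fintype n] [DecidableEq n]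
    (α β : ℝ) (e : m ≃ n) (y : Matrix n n ℝ) :
    matrixBeta α β (y.submatrix e e) = matrixBeta α β y := by
  have h : 1 - y.submatrix e e = (1 - y).submatrix e e := by
    ext i j
    simp [Matrix.one_apply]
  have hiff : y.submatrix e e ∈ matrixInterval m ↔ y ∈ matrixInterval n := by
    simp only [matrixInterval, Set.mem_ofPred_eq, h, posSemidef_submatrix_equiv]
  by_cases hy : y ∈ matrixInterval n
  · simp only [matrixBeta, Set.indicator_of_mem hy, Set.indicator_of_mem (hiff.2 hy), h,
      det_submatrix_equiv_self]
  · simp only [matrixBeta, Set.indicator_of_notMem hy, Set.indicator_of_notMem (mt hiff.1 hy)]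

lemma det_inv_add_inv_one_sub {n : Type*} [Fintype n] [DecidableEq n] {D : Matrix n n ℝ}
    (hD : D.det ≠ 0) (hD' : (1 - D).det ≠ 0) :
    (D⁻¹ + (1 - D)⁻¹).det = (D.det * (1 - D).det)⁻¹ := by
  rw [Matrix.inv_add_inv (by simp [isUnit_iff_isUnit_det, hD, hD']), add_sub_cancel, Matrix.mul_one,
    det_mul, det_nonsing_inv, det_nonsing_inv, Ring.inverse_eq_inv', mul_inv]

lemma lintegral_matrixBeta_bordered_entry {n : Type*} [Fintype n] [DecidableEq n] {α β : ℝ}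
    (hα : -1 < α) (hβ : -1 < β) {D : Matrix n n ℝ} (hD : D.PosDef) (hD' : (1 - D).PosDef)
    (b : n → ℝ) :
    ∫⁻ a, matrixBeta α β (bordered D b a) =
      {b : n → ℝ | 0 < 1 - b ⬝ᵥ (D⁻¹ + (1 - D)⁻¹) *ᵥ b}.indicator (fun b =>
        ENNReal.ofReal ((1 - b ⬝ᵥ (D⁻¹ + (1 - D)⁻¹) *ᵥ b) ^ (α + β + 1)) *
        ENNReal.ofReal (D.det ^ α * (1 - D).det ^ β *
          ProbabilityTheory.beta (α + 1) (β + 1))) b := by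
  set s := b ⬝ᵥ D⁻¹ *ᵥ b with hs
  set r := 1 - b ⬝ᵥ (1 - D)⁻¹ *ᵥ b with hr
  have hsr : 1 - b ⬝ᵥ (D⁻¹ + (1 - D)⁻¹) *ᵥ b = r - s := by
    rw [add_mulVec, dotProduct_add, hs, hr]
    ring
  have hdet := hD.det_pos
  have hdet' := hD'.det_pos
  have key : ∀ a, matrixBeta α β (bordered D b a) = (Set.Icc s r).indicator (fun a =>
      ENNReal.ofReal (D.det ^ α * (1 - D).det ^ β) *
      ENNReal.ofReal ((a - s) ^ α * (r - a) ^ β)) a := by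
    intro a
    have hiff : bordered D b a ∈ matrixInterval (n ⊕ Fin 1) ↔ a ∈ Set.Icc s r := by
      rw [matrixInterval, Set.mem_ofPred_eq, one_sub_bordered, posSemidef_bordered_iff hD,
        posSemidef_bordered_iff hD', Set.mem_Icc, mulVec_neg, neg_dotProduct_neg]
      rw [hr, le_sub_comm]
    simp only [matrixBeta, Set.indicator, hiff]
    split_ifs with ha
    · rw [← ENNReal.ofReal_mul (by positivity), one_sub_bordered, det_bordered hdet.ne',
        det_bordered hdet'.ne', mulVec_neg, neg_dotProduct_neg, ← hs,
        show 1 - a - b ⬝ᵥ (1 - D)⁻¹ *ᵥ b = r - a by rw [hr]; ring,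
        Real.mul_rpow hdet.le (sub_nonneg.2 ha.1), Real.mul_rpow hdet'.le (sub_nonneg.2 ha.2)]
      ring_nf
    · rfl
  simp_rw [key]
  rw [lintegral_indicator measurableSet_Icc, lintegral_const_mul' _ _ ENNReal.ofReal_ne_top,
    ← Measure.restrict_congr_set Ioo_ae_eq_Icc]
  simp only [Set.indicator, Set.mem_ofPred_eq, hsr]
  split_ifs with h
  · rw [sub_pos] at h
    rw [lintegral_affine_beta hα hβ h, ← ENNReal.ofReal_mul (by positivity),
      ← ENNReal.ofReal_mul (Real.rpow_nonneg (sub_pos.2 h).le _)]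
    ring_nf
  · simp [Set.Ioo_eq_empty (mt sub_pos.2 h)]

lemma lintegral_matrixBeta_bordered {q : ℕ} {α β : ℝ} (hα : -1 < α) (hβ : -1 < β)
    (hαβ : -1 < α + β + 1) {D : Matrix (Fin q) (Fin q) ℝ} (hD : D.det ≠ 0)
    (hD' : (1 - D).det ≠ 0) :
    ∫⁻ b, ∫⁻ a, matrixBeta α β (bordered D b a) =
      matrixBeta (α + 1 / 2) (β + 1 / 2) D *
        ENNReal.ofReal (Real.pi ^ ((q : ℝ) / 2) * (Real.Gamma (α + 1) * Real.Gamma (β + 1) /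
          Real.Gamma (α + β + 2 + q / 2))) := by
  by_cases hmem : D ∈ matrixInterval (Fin q)
  · replace hD := hmem.1.posDef_iff_det_ne_zero.2 hD
    replace hD' := hmem.2.posDef_iff_det_ne_zero.2 hD'
    have hdet := hD.det_pos
    have hdet' := hD'.det_pos
    simp_rw [lintegral_matrixBeta_bordered_entry hα hβ hD hD']
    have hmeas : MeasurableSet {b : Fin q → ℝ | 0 < 1 - b ⬝ᵥ (D⁻¹ + (1 - D)⁻¹) *ᵥ b} :=
      measurableSet_lt measurable_const (by unfold mulVec dotProduct; fun_prop)
    rw [lintegral_indicator hmeas, lintegral_mul_const' _ _ ENNReal.ofReal_ne_top,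
      lintegral_quadForm_rpow hαβ (hD.inv.add hD'.inv), det_inv_add_inv_one_sub hdet.ne' hdet'.ne',
      matrixBeta, Set.indicator_of_mem hmem, ← ENNReal.ofReal_mul (by positivity),
      ← ENNReal.ofReal_mul, ← ENNReal.ofReal_mul (by positivity)]
    · have hG : 0 < Real.Gamma (α + β + 2) := Real.Gamma_pos_of_pos (by linarith)
      congr 1
      rw [Real.inv_rpow (by positivity), Real.rpow_neg (by positivity), inv_inv,
        Real.mul_rpow hdet.le hdet'.le, Real.rpow_add hdet, Real.rpow_add hdet',
        ProbabilityTheory.beta, show α + β + 1 + 1 = α + β + 2 by ring,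
        show α + 1 + (β + 1) = α + β + 2 by ring]
      generalize Real.Gamma (α + β + 2) = G at *
      field_simp
    · have h1 : 0 < Real.Gamma (α + β + 1 + 1) := Real.Gamma_pos_of_pos (by linarith)
      have h2 : 0 < Real.Gamma (α + β + 1 + 1 + q / 2) := Real.Gamma_pos_of_pos (by
        have : (0 : ℝ) ≤ q / 2 := by positivity
        linarith)
      positivity
  · have hzero : ∀ b a, matrixBeta α β (bordered D b a) = 0 := fun b a =>
      Set.indicator_of_notMem (fun h => hmem ⟨posSemidef_of_bordered h.1,
        posSemidef_of_bordered (one_sub_bordered (D := D) ▸ h.2)⟩) _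
    simp only [hzero, lintegral_zero]
    rw [matrixBeta, Set.indicator_of_notMem hmem, zero_mul]

instance matrixBorelSpace (q : ℕ) : BorelSpace (Matrix (Fin q) (Fin q) ℝ) :=
  inferInstanceAs (BorelSpace (Fin q → Fin q → ℝ))

lemma measurable_toSym (q : ℕ) : Measurable (toSym q) := by
  refine measurable_pi_lambda _ fun i => measurable_pi_lambda _ fun j => ?_
  unfold toSym
  split_ifs <;> fun_prop

lemma measurable_matrix_det (q : ℕ) :
    Measurable (det : Matrix (Fin q) (Fin q) ℝ → ℝ) :=
  continuous_id.matrix_det.measurable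

lemma measurable_matrix_det_one_sub (q : ℕ) :
    Measurable fun y : Matrix (Fin q) (Fin q) ℝ => (1 - y).det :=
  (continuous_const.sub continuous_id).matrix_det.measurable

lemma isClosed_posSemidef (n : Type*) [Fintype n] :
    IsClosed {y : Matrix n n ℝ | y.PosSemidef} := by
  simp only [posSemidef_iff_dotProduct_mulVec, Matrix.IsHermitian, Set.ofPred_and,
    Set.ofPred_forall]
  exact (isClosed_eq continuous_id.matrix_conjTranspose continuous_id).inter <|
    isClosed_iInter fun x => isClosed_le continuous_const <|
      continuous_const.dotProduct (continuous_id.matrix_mulVec continuous_const)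

lemma measurableSet_matrixInterval (q : ℕ) : MeasurableSet (matrixInterval (Fin q)) :=
  ((isClosed_posSemidef (Fin q)).inter <| (isClosed_posSemidef (Fin q)).preimage <|
    continuous_const.sub continuous_id).measurableSet

lemma measurable_matrixBeta (q : ℕ) (α β : ℝ) :
    Measurable (matrixBeta α β : Matrix (Fin q) (Fin q) ℝ → ENNReal) := by
  have h := measurable_matrix_det q
  have h' := measurable_matrix_det_one_sub q
  exact Measurable.indicator (by fun_prop) (measurableSet_matrixInterval q)

/-- The upper-triangular coordinates of a symmetric matrix of size `q + 1`, split into those of its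
leading `q × q` block, the rest of the last column, and the last diagonal entry. -/
noncomputable def symIdxSuccEquiv (q : ℕ) : SymIdx q ⊕ (Fin q ⊕ Unit) ≃ SymIdx (q + 1) :=
  Equiv.ofBijective
    (Sum.elim (fun p => ⟨(p.1.1.castSucc, p.1.2.castSucc), Fin.castSucc_le_castSucc_iff.2 p.2⟩)
      (Sum.elim (fun i => ⟨(i.castSucc, Fin.last q), Fin.le_last _⟩)
        fun _ => ⟨(Fin.last q, Fin.last q), le_rfl⟩)) <| by
    constructor
    · rintro (⟨⟨i, j⟩, h⟩ | i | _) (⟨⟨k, l⟩, h'⟩ | k | _) <;>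
        simp [Fin.castSucc_ne_last, (Fin.castSucc_ne_last _).symm]
    · rintro ⟨⟨i, j⟩, h⟩
      induction i using Fin.lastCases with
      | last =>
        obtain rfl : j = Fin.last q := le_antisymm (Fin.le_last _) h
        exact ⟨.inr (.inr ()), rfl⟩
      | cast i =>
        induction j using Fin.lastCases with
        | last => exact ⟨.inr (.inl i), rfl⟩
        | cast j => exact ⟨.inl ⟨(i, j), Fin.castSucc_le_castSucc_iff.1 h⟩, rfl⟩

/-- Splitting of the coordinates of a symmetric matrix of size `q + 1` along `symIdxSuccEquiv`. -/
noncomputable def symSplit (q : ℕ) :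
    (SymIdx (q + 1) → ℝ) ≃ᵐ (SymIdx q → ℝ) × (Fin q → ℝ) × ℝ :=
  (MeasurableEquiv.piCongrLeft (fun _ => ℝ) (symIdxSuccEquiv q)).symm.trans <|
    (MeasurableEquiv.sumPiEquivProdPi fun _ => ℝ).trans <|
      (MeasurableEquiv.refl _).prodCongr <|
        (MeasurableEquiv.sumPiEquivProdPi fun _ => ℝ).trans <|
          (MeasurableEquiv.refl _).prodCongr (MeasurableEquiv.funUnique Unit ℝ)

lemma measurePreserving_symSplit (q : ℕ) : MeasurePreserving (symSplit q) :=
  (volume_measurePreserving_piCongrLeft (fun _ => ℝ) (symIdxSuccEquiv q)).symm.trans <|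
    (volume_measurePreserving_sumPiEquivProdPi fun _ => ℝ).trans <|
      (MeasurePreserving.id _).prod <|
        (volume_measurePreserving_sumPiEquivProdPi fun _ => ℝ).trans <|
          (MeasurePreserving.id _).prod (volume_preserving_funUnique Unit ℝ)

lemma symSplit_apply (q : ℕ) (c : SymIdx (q + 1) → ℝ) :
    symSplit q c = (fun p => c (symIdxSuccEquiv q (.inl p)),
      fun i => c (symIdxSuccEquiv q (.inr (.inl i))), c (symIdxSuccEquiv q (.inr (.inr ())))) :=
  rfl

lemma toSym_succ (q : ℕ) (c : SymIdx (q + 1) → ℝ) :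
    (toSym (q + 1) c).submatrix finSumFinEquiv finSumFinEquiv =
      bordered (toSym q (symSplit q c).1) (symSplit q c).2.1 (symSplit q c).2.2 := by
  have hlast : ∀ j : Fin 1, Fin.natAdd q j = Fin.last q := fun j => by
    rw [Subsingleton.elim j 0]; rfl
  ext (i | i) (j | j)
  · simp [bordered, toSym, symSplit_apply, symIdxSuccEquiv]
    rfl
  · simp [bordered, toSym, symSplit_apply, hlast, Fin.le_last]
    rfl
  · have hne : Fin.castAdd 1 j ≠ Fin.last q := Fin.castSucc_ne_last j
    simp [bordered, toSym, symSplit_apply, hlast, hne]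
    rfl
  · simp [bordered, toSym, symSplit_apply, hlast]
    rfl

lemma lintegral_symSplit (q : ℕ) {F : (SymIdx q → ℝ) × (Fin q → ℝ) × ℝ → ENNReal}
    (hF : Measurable F) :
    ∫⁻ c, F (symSplit q c) = ∫⁻ c, ∫⁻ b, ∫⁻ a, F (c, b, a) := by
  rw [(measurePreserving_symSplit q).lintegral_comp hF, Measure.volume_eq_prod,
    lintegral_prod _ hF.aemeasurable]
  refine lintegral_congr fun c => ?_
  rw [Measure.volume_eq_prod, lintegral_prod _ (by fun_prop)]

lemma ae_det_toSym_ne_zero (q : ℕ) :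
    ∀ᵐ c, (toSym q c).det ≠ 0 ∧ (1 - toSym q c).det ≠ 0 := by
  induction q with
  | zero => simp
  | succ q ih =>
    have hmeas : MeasurableSet
        {c | (toSym (q + 1) c).det ≠ 0 ∧ (1 - toSym (q + 1) c).det ≠ 0} :=
      (((measurable_matrix_det _).comp (measurable_toSym _))
        (measurableSet_singleton (0 : ℝ)).compl).inter
      (((measurable_matrix_det_one_sub _).comp (measurable_toSym _))
        (measurableSet_singleton (0 : ℝ)).compl)
    have hdet : ∀ c, ((toSym (q + 1) c).det ≠ 0 ∧ (1 - toSym (q + 1) c).det ≠ 0) ↔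
        (bordered (toSym q (symSplit q c).1) (symSplit q c).2.1 (symSplit q c).2.2).det ≠ 0 ∧
        (1 - bordered (toSym q (symSplit q c).1) (symSplit q c).2.1 (symSplit q c).2.2).det ≠ 0 :=
      by
      intro c
      rw [← toSym_succ, ← submatrix_one_equiv finSumFinEquiv, ← Pi.sub_apply, ← Pi.sub_apply,
        ← submatrix_sub, det_submatrix_equiv_self, det_submatrix_equiv_self]
    rw [← (measurePreserving_symSplit q).symm.map_eq, ae_map_iff
      (symSplit q).symm.measurable.aemeasurable hmeas]
    have hmeas' := (symSplit q).symm.measurable hmeas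
    simp only [Set.preimage, Set.mem_ofPred_eq] at hmeas'
    rw [Measure.volume_eq_prod, Measure.ae_prod_iff_ae_ae hmeas']
    filter_upwards [ih] with c hc
    rw [Measure.volume_eq_prod]
    refine (Measure.ae_prod_iff_ae_ae (measurable_prodMk_left hmeas')).2 ?_
    refine .of_forall fun b => ?_
    filter_upwards [Measure.ae_ne volume (b ⬝ᵥ (toSym q c)⁻¹ *ᵥ b),
      Measure.ae_ne volume (1 - (-b) ⬝ᵥ (1 - toSym q c)⁻¹ *ᵥ (-b))] with a ha ha'
    refine (hdet _).2 ?_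
    rw [MeasurableEquiv.apply_symm_apply, one_sub_bordered, det_bordered hc.1, det_bordered hc.2]
    exact ⟨mul_ne_zero hc.1 (sub_ne_zero.2 ha),
      mul_ne_zero hc.2 fun h => ha' (by linarith)⟩

lemma GammaOmegaR_succ (q : ℕ) (μ : ℝ) :
    GammaOmegaR (q + 1) μ =
      GammaOmegaR q μ * (Real.pi ^ ((q : ℝ) / 2) * Real.Gamma (μ - q / 2)) := by
  have h : ((((q + 1) * (q + 1 - 1) : ℕ) : ℝ)) / 4 = ((q * (q - 1) : ℕ) : ℝ) / 4 + q / 2 := by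
    cases q <;> simp
    ring
  rw [GammaOmegaR, GammaOmegaR, Finset.prod_range_succ, h, Real.rpow_add Real.pi_pos]
  ring

lemma GammaOmegaR_pos (q : ℕ) {μ : ℝ} (hμ : ((q : ℝ) - 1) / 2 < μ) : 0 < GammaOmegaR q μ := by
  refine mul_pos (Real.rpow_pos_of_pos Real.pi_pos _) <| Finset.prod_pos fun j hj => ?_
  have hj' : (j : ℝ) + 1 ≤ q := by exact_mod_cast Finset.mem_range.1 hj
  exact Real.Gamma_pos_of_pos (by linarith)

lemma lintegral_matrixBeta_toSym (q : ℕ) {μ ν : ℝ} (hμ : ((q : ℝ) - 1) / 2 < μ)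
    (hν : ((q : ℝ) - 1) / 2 < ν) :
    ∫⁻ c, matrixBeta (μ - ((q : ℝ) + 1) / 2) (ν - ((q : ℝ) + 1) / 2) (toSym q c) =
      ENNReal.ofReal (GammaOmegaR q μ * GammaOmegaR q ν / GammaOmegaR q (μ + ν)) := by
  induction q with
  | zero =>
    have hmem : ∀ c, toSym 0 c ∈ matrixInterval (Fin 0) := fun c => by
      have h0 : ∀ y : Matrix (Fin 0) (Fin 0) ℝ, y.PosSemidef := fun y =>
        Subsingleton.elim 0 y ▸ PosSemidef.zero
      exact ⟨h0 _, h0 _⟩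
    simp only [matrixBeta, Set.indicator_of_mem (hmem _)]
    rw [volume_pi, Measure.pi_of_empty]
    simp [GammaOmegaR]
  | succ q ih =>
    push_cast at hμ hν ⊢
    set α := μ - ((q : ℝ) + 1 + 1) / 2 with hα
    set β := ν - ((q : ℝ) + 1 + 1) / 2 with hβ
    have hsucc : ∀ c, matrixBeta α β (toSym (q + 1) c) =
        matrixBeta α β (bordered (toSym q (symSplit q c).1) (symSplit q c).2.1
          (symSplit q c).2.2) := fun c => by
      rw [← toSym_succ, matrixBeta_submatrix]
    have hmeas : Measurable fun x : (SymIdx q → ℝ) × (Fin q → ℝ) × ℝ =>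
        matrixBeta α β (bordered (toSym q x.1) x.2.1 x.2.2) := by
      have := ((measurable_matrixBeta (q + 1) α β).comp (measurable_toSym _)).comp
        (symSplit q).symm.measurable
      simpa only [Function.comp_def, hsucc, MeasurableEquiv.apply_symm_apply] using this
    simp_rw [hsucc]
    rw [lintegral_symSplit q hmeas]
    have hae : ∀ᵐ c, ∫⁻ b, ∫⁻ a, matrixBeta α β (bordered (toSym q c) b a) =
        matrixBeta (α + 1 / 2) (β + 1 / 2) (toSym q c) *
        ENNReal.ofReal (Real.pi ^ ((q : ℝ) / 2) * (Real.Gamma (α + 1) * Real.Gamma (β + 1) /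
          Real.Gamma (α + β + 2 + q / 2))) := by
      filter_upwards [ae_det_toSym_ne_zero q] with c hc
      exact lintegral_matrixBeta_bordered (by linarith) (by linarith) (by linarith) hc.1 hc.2
    rw [lintegral_congr_ae hae, lintegral_mul_const' _ _ ENNReal.ofReal_ne_top,
      show α + 1 / 2 = μ - ((q : ℝ) + 1) / 2 by rw [hα]; ring,
      show β + 1 / 2 = ν - ((q : ℝ) + 1) / 2 by rw [hβ]; ring,
      show α + 1 = μ - q / 2 by rw [hα]; ring, show β + 1 = ν - q / 2 by rw [hβ]; ring,
      show α + β + 2 + q / 2 = μ + ν - q / 2 by rw [hα, hβ]; ring,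
      ih (by linarith) (by linarith), ← ENNReal.ofReal_mul]
    · congr 1
      simp only [GammaOmegaR_succ]
      generalize Real.Gamma (μ + ν - q / 2) = G
      field_simp
    · have hq : (0 : ℝ) ≤ q := q.cast_nonneg
      have h1 := GammaOmegaR_pos q (μ := μ) (by linarith)
      have h2 := GammaOmegaR_pos q (μ := ν) (by linarith)
      have h3 := GammaOmegaR_pos q (μ := μ + ν) (by linarith)
      positivity

/-- For real `μ, ν > (q−1)/2`, the matrix beta integral over
`Π_q^I = {0 ≤ y ≤ I}` equals `Γ_Ω(μ)Γ_Ω(ν)/Γ_Ω(μ+ν)`. -/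
theorem stmt9 (q : ℕ) (μ ν : ℝ) (hμ : ((q : ℝ) - 1) / 2 < μ) (hν : ((q : ℝ) - 1) / 2 < ν) :
    ∫ y in {y : Matrix (Fin q) (Fin q) ℝ | y.PosSemidef ∧ (1 - y).PosSemidef},
        y.det ^ (μ - ((q : ℝ) + 1) / 2) * (1 - y).det ^ (ν - ((q : ℝ) + 1) / 2)
        ∂(symMeasure q)
      = GammaOmegaR q μ * GammaOmegaR q ν / GammaOmegaR q (μ + ν) := by
  have hdet := measurable_matrix_det q
  have hdet' := measurable_matrix_det_one_sub q
  have hset := measurableSet_matrixInterval q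
  change ∫ y in matrixInterval (Fin q), _ ∂_ = _
  rw [integral_eq_lintegral_of_nonneg_ae
    (ae_restrict_of_forall_mem hset fun y hy =>
      mul_nonneg (Real.rpow_nonneg hy.1.det_nonneg _) (Real.rpow_nonneg hy.2.det_nonneg _))
    (Measurable.aestronglyMeasurable (by fun_prop))]
  rw [← lintegral_indicator hset]
  change (∫⁻ y, matrixBeta _ _ y ∂_).toReal = _
  rw [symMeasure, lintegral_map (measurable_matrixBeta q _ _) (measurable_toSym q),
    lintegral_matrixBeta_toSym q hμ hν, ENNReal.toReal_ofReal]
  by_cases hq : q = 0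
  · subst hq
    simp [GammaOmegaR]
  have hq' : (1 : ℝ) ≤ q := by exact_mod_cast Nat.one_le_iff_ne_zero.2 hq
  have h1 := GammaOmegaR_pos q hμ
  have h2 := GammaOmegaR_pos q hν
  have h3 := GammaOmegaR_pos q (μ := μ + ν) (by linarith)
  positivity
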